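/- The scalar curvature of the canonical connection of n_p equals s^∇ = −12λ²(p + 2): with R(X, Y)Z := λ² Σ_{i=1}^{3} Hᵢ(X, Y)·HᵢZ, Ric(X, Y) := Σ_a g_λ(R(e_a, X)Y, e_a), and (e_a) the orthonormal basis ξ₁, ξ₂, ξ₃, τ₁, …, τ_{4p}, one has Σ_a Ric(e_a, e_a) = −12λ²(p + 2). -/

import Mathlib

/-! Common setup: the quaternionic Heisenberg Lie algebra `n_p` of dimension `4p+3`,
realised as `ℝ^{4p+3}` with orthonormal basis `ξ₁ ξ₂ ξ₃ τ₁ … τ_{4p}`. -/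

noncomputable section

open scoped BigOperators

/-- The underlying vector space of the quaternionic Heisenberg Lie algebra `n_p`. -/
abbrev NV (p : ℕ) : Type := Fin (4 * p + 3) → ℝ

/-- The inner product `g_λ` for which the standard basis is orthonormal. -/
def gIP {p : ℕ} (X Y : NV p) : ℝ := ∑ a, X a * Y a

/-- Index of the basis vector `ξ_{i+1}`, `i = 0, 1, 2`. -/
def zI (p : ℕ) (i : Fin 3) : Fin (4 * p + 3) := ⟨i.val, by have := i.isLt; omega⟩

/-- Index of the basis vector `τ_{ip + r + 1}`, `i = 0, 1, 2, 3`, `r = 0, …, p-1`. -/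
def tI (p : ℕ) (i : Fin 4) (r : Fin p) : Fin (4 * p + 3) :=
  ⟨3 + i.val * p + r.val, by
    have h1 := i.isLt; have h2 := r.isLt
    have h3 : i.val * p ≤ 3 * p := Nat.mul_le_mul_right p (by omega)
    omega⟩

/-- The basis vector `ξ_{i+1}`. -/
def xi (p : ℕ) (i : Fin 3) : NV p := Pi.single (zI p i) 1

/-- The basis vector `τ_{ip + r + 1}`. -/
def tau (p : ℕ) (i : Fin 4) (r : Fin p) : NV p := Pi.single (tI p i r) 1

/-- The Lie bracket of `n_p`: the bilinear extension of
`[τ_r, τ_{p+r}] = [τ_{2p+r}, τ_{3p+r}] = λ ξ₁`, `[τ_r, τ_{2p+r}] = [τ_{3p+r}, τ_{p+r}] = λ ξ₂`,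
`[τ_r, τ_{3p+r}] = [τ_{p+r}, τ_{2p+r}] = λ ξ₃`, all other brackets of basis vectors being zero. -/
def bracket (p : ℕ) (lam : ℝ) (X Y : NV p) : NV p :=
  (lam * ∑ r : Fin p,
      (X (tI p 0 r) * Y (tI p 1 r) - X (tI p 1 r) * Y (tI p 0 r)
        + X (tI p 2 r) * Y (tI p 3 r) - X (tI p 3 r) * Y (tI p 2 r))) • xi p 0
  + (lam * ∑ r : Fin p,
      (X (tI p 0 r) * Y (tI p 2 r) - X (tI p 2 r) * Y (tI p 0 r)
        + X (tI p 3 r) * Y (tI p 1 r) - X (tI p 1 r) * Y (tI p 3 r))) • xi p 1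
  + (lam * ∑ r : Fin p,
      (X (tI p 0 r) * Y (tI p 3 r) - X (tI p 3 r) * Y (tI p 0 r)
        + X (tI p 1 r) * Y (tI p 2 r) - X (tI p 2 r) * Y (tI p 1 r))) • xi p 2

/-- `dη_i(X, Y) := -η_i([X, Y])`. -/
def dEta (p : ℕ) (lam : ℝ) (i : Fin 3) (X Y : NV p) : ℝ := -(bracket p lam X Y (zI p i))

/-- The three almost contact endomorphisms `φ₁, φ₂, φ₃` of `n_p`. -/
def phi (p : ℕ) : Fin 3 → NV p → NV p :=
  ![fun X => X (zI p 1) • xi p 2 - X (zI p 2) • xi p 1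
      + ∑ r : Fin p, (X (tI p 0 r) • tau p 1 r - X (tI p 1 r) • tau p 0 r
          + X (tI p 2 r) • tau p 3 r - X (tI p 3 r) • tau p 2 r),
    fun X => X (zI p 2) • xi p 0 - X (zI p 0) • xi p 2
      + ∑ r : Fin p, (X (tI p 0 r) • tau p 2 r - X (tI p 2 r) • tau p 0 r
          + X (tI p 3 r) • tau p 1 r - X (tI p 1 r) • tau p 3 r),
    fun X => X (zI p 0) • xi p 1 - X (zI p 1) • xi p 0
      + ∑ r : Fin p, (X (tI p 0 r) • tau p 3 r - X (tI p 3 r) • tau p 0 r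
          + X (tI p 1 r) • tau p 2 r - X (tI p 2 r) • tau p 1 r)]

/-- `(η_i ∧ η_j)(X, Y)`. -/
def etaWedge (p : ℕ) (i j : Fin 3) (X Y : NV p) : ℝ :=
  X (zI p i) * Y (zI p j) - Y (zI p i) * X (zI p j)

/-- The 2-forms `H₁ = -(1/λ)dη₁ + 2 η₂∧η₃`, `H₂ = -(1/λ)dη₂ - 2 η₁∧η₃`,
`H₃ = -(1/λ)dη₃ + 2 η₁∧η₂`. -/
def Hform (p : ℕ) (lam : ℝ) : Fin 3 → NV p → NV p → ℝ :=
  ![fun X Y => -(1 / lam) * dEta p lam 0 X Y + 2 * etaWedge p 1 2 X Y,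
    fun X Y => -(1 / lam) * dEta p lam 1 X Y - 2 * etaWedge p 0 2 X Y,
    fun X Y => -(1 / lam) * dEta p lam 2 X Y + 2 * etaWedge p 0 1 X Y]

/-- The 2-form `H_i` regarded as an endomorphism of `n_p` via `g_λ(H_i X, Y) = H_i(X, Y)`. -/
def Hend (p : ℕ) (lam : ℝ) (i : Fin 3) (X : NV p) : NV p :=
  fun b => Hform p lam i X (Pi.single b 1)

/-- `(η₁ ∧ η₂ ∧ η₃)(X, Y, Z)`. -/
def det3 (p : ℕ) (X Y Z : NV p) : ℝ :=
  X (zI p 0) * (Y (zI p 1) * Z (zI p 2) - Y (zI p 2) * Z (zI p 1))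
  - Y (zI p 0) * (X (zI p 1) * Z (zI p 2) - X (zI p 2) * Z (zI p 1))
  + Z (zI p 0) * (X (zI p 1) * Y (zI p 2) - X (zI p 2) * Y (zI p 1))

/-- The torsion 3-form `T = η₁∧dη₁ + η₂∧dη₂ + η₃∧dη₃ - 4λ η₁∧η₂∧η₃`. -/
def Tform (p : ℕ) (lam : ℝ) (X Y Z : NV p) : ℝ :=
  (∑ i : Fin 3,
    (X (zI p i) * dEta p lam i Y Z - Y (zI p i) * dEta p lam i X Z
      + Z (zI p i) * dEta p lam i X Y)) - 4 * lam * det3 p X Y Z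

/-- The standard basis vector `e_a` of `n_p`. -/
def basisE (p : ℕ) (a : Fin (4 * p + 3)) : NV p := Pi.single a 1

end

/-- The curvature operator `R(X,Y)Z = λ² Σᵢ Hᵢ(X,Y)·HᵢZ` of the canonical connection. -/
noncomputable def Rop (p : ℕ) (lam : ℝ) (X Y Z : NV p) : NV p :=
  lam ^ 2 • ∑ i : Fin 3, Hform p lam i X Y • Hend p lam i Z

/-- Its Ricci tensor `Ric(X,Y) = Σₐ g_λ(R(eₐ, X)Y, eₐ)`. -/
noncomputable def RicT (p : ℕ) (lam : ℝ) (X Y : NV p) : ℝ :=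
  ∑ a, gIP (Rop p lam (basisE p a) X Y) (basisE p a)

lemma zI_injective (p : ℕ) : Function.Injective (zI p) := fun i j h => by
  simpa [zI, Fin.ext_iff] using h

lemma tI_inj {p : ℕ} {i j : Fin 4} {r s : Fin p} :
    tI p i r = tI p j s ↔ i = j ∧ r = s := by
  refine ⟨fun h => ?_, fun ⟨hi, hr⟩ => by rw [hi, hr]⟩
  have hr := r.isLt
  have hs := s.isLt
  simp only [tI, Fin.ext_iff] at h ⊢
  fin_cases i <;> fin_cases j <;> simp at h ⊢ <;> omega

lemma zI_ne_tI {p : ℕ} (i : Fin 3) (j : Fin 4) (r : Fin p) : zI p i ≠ tI p j r := by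
  have := i.isLt
  simp only [zI, tI, ne_eq, Fin.ext_iff]
  omega

/-- A sum over the basis of `n_p` splits into its vertical and horizontal parts. -/
lemma sum_eq_sum_zI_add_sum_tI {M : Type*} [AddCommMonoid M] {p : ℕ} (f : Fin (4 * p + 3) → M) :
    ∑ a, f a = ∑ i, f (zI p i) + ∑ i, ∑ r, f (tI p i r) := by
  have hb : Function.Bijective
      (Sum.elim (zI p) (fun x : Fin 4 × Fin p => tI p x.1 x.2)) := by
    rw [Fintype.bijective_iff_injective_and_card]
    refine ⟨(zI_injective p).sumElim (fun x y h => ?_) (fun i x => zI_ne_tI i x.1 x.2), ?_⟩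
    · exact Prod.ext_iff.mpr (tI_inj.mp h)
    · simp [add_comm]
  rw [← Fintype.sum_bijective _ hb (fun x => f (Sum.elim _ _ x)) f (fun _ => rfl),
    Fintype.sum_sum_type, Fintype.sum_prod_type]
  rfl

@[simp]
lemma xi_zI (p : ℕ) (i j : Fin 3) : xi p i (zI p j) = if j = i then 1 else 0 := by
  simp [xi, Pi.single_apply, (zI_injective p).eq_iff]

@[simp]
lemma xi_tI (p : ℕ) (i : Fin 3) (j : Fin 4) (r : Fin p) : xi p i (tI p j r) = 0 := by
  simp [xi, (zI_ne_tI i j r).symm]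

@[simp]
lemma tau_zI (p : ℕ) (i : Fin 4) (r : Fin p) (j : Fin 3) : tau p i r (zI p j) = 0 := by
  simp [tau, zI_ne_tI]

@[simp]
lemma tau_tI (p : ℕ) (i j : Fin 4) (r s : Fin p) :
    tau p i r (tI p j s) = if j = i ∧ s = r then 1 else 0 := by
  simp [tau, Pi.single_apply, tI_inj]

/-- The coefficients of `Hᵢ` on the vertical vectors `ξ₁, ξ₂, ξ₃`. -/
def verticalCoeff : Fin 3 → Matrix (Fin 3) (Fin 3) ℝ :=
  ![!![0, 0, 0; 0, 0, 2; 0, -2, 0], !![0, 0, -2; 0, 0, 0; 2, 0, 0], !![0, 2, 0; -2, 0, 0; 0, 0, 0]]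

/-- The coefficients of `Hᵢ` on each horizontal block `τ_r, τ_{p+r}, τ_{2p+r}, τ_{3p+r}`. -/
def horizontalCoeff : Fin 3 → Matrix (Fin 4) (Fin 4) ℝ :=
  ![!![0, 1, 0, 0; -1, 0, 0, 0; 0, 0, 0, 1; 0, 0, -1, 0],
    !![0, 0, 1, 0; 0, 0, 0, -1; -1, 0, 0, 0; 0, 1, 0, 0],
    !![0, 0, 0, 1; 0, 0, 1, 0; 0, -1, 0, 0; -1, 0, 0, 0]]

/-- The form `Hᵢ` in coordinates. -/
lemma Hform_apply (p : ℕ) {lam : ℝ} (hlam : lam ≠ 0) (k : Fin 3) (X Y : NV p) :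
    Hform p lam k X Y =
      ∑ i, ∑ j, verticalCoeff k i j * (X (zI p i) * Y (zI p j)) +
        ∑ r, ∑ i, ∑ j, horizontalCoeff k i j * (X (tI p i r) * Y (tI p j r)) := by
  fin_cases k <;>
  · simp [Hform, dEta, bracket, etaWedge, verticalCoeff, horizontalCoeff, hlam,
      Fin.sum_univ_three, Fin.sum_univ_four, Finset.sum_add_distrib]
    ring

lemma Hform_xi_xi (p : ℕ) {lam : ℝ} (hlam : lam ≠ 0) (k i j : Fin 3) :
    Hform p lam k (xi p i) (xi p j) = verticalCoeff k i j := by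
  simp [Hform_apply p hlam]

lemma Hform_xi_tau (p : ℕ) {lam : ℝ} (hlam : lam ≠ 0) (k i : Fin 3) (j : Fin 4) (r : Fin p) :
    Hform p lam k (xi p i) (tau p j r) = 0 := by
  simp [Hform_apply p hlam]

lemma Hform_tau_xi (p : ℕ) {lam : ℝ} (hlam : lam ≠ 0) (k i : Fin 3) (j : Fin 4) (r : Fin p) :
    Hform p lam k (tau p j r) (xi p i) = 0 := by
  simp [Hform_apply p hlam]

lemma Hform_tau_tau (p : ℕ) {lam : ℝ} (hlam : lam ≠ 0) (k : Fin 3) (i j : Fin 4) (r s : Fin p) :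
    Hform p lam k (tau p i r) (tau p j s) = if r = s then horizontalCoeff k i j else 0 := by
  simp [Hform_apply p hlam, ite_and, eq_comm (a := r)]

/-- The trace of the square of `Hᵢ`. -/
lemma sum_Hform_mul_Hform (p : ℕ) {lam : ℝ} (hlam : lam ≠ 0) (k : Fin 3) :
    ∑ a, ∑ b, Hform p lam k (basisE p b) (basisE p a) * Hform p lam k (basisE p a) (basisE p b)
      = -4 * ((p : ℝ) + 2) := by
  have hz : ∀ i, basisE p (zI p i) = xi p i := fun _ => rfl
  have ht : ∀ i r, basisE p (tI p i r) = tau p i r := fun _ _ => rfl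
  simp only [sum_eq_sum_zI_add_sum_tI, hz, ht, Hform_xi_xi p hlam,
    Hform_xi_tau p hlam, Hform_tau_xi p hlam,
    Hform_tau_tau p hlam]
  fin_cases k <;>
    simp [Fin.sum_univ_three, Fin.sum_univ_four, verticalCoeff, horizontalCoeff] <;> ring

lemma RicT_eq (p : ℕ) (lam : ℝ) (X Y : NV p) :
    RicT p lam X Y = lam ^ 2 *
      ∑ k, ∑ b, Hform p lam k (basisE p b) X * Hform p lam k Y (basisE p b) := by
  rw [Finset.sum_comm, Finset.mul_sum]
  simp [RicT, Rop, gIP, Hend, basisE, Pi.single_apply]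

/-- the scalar curvature of the canonical connection equals `-12λ²(p+2)`. -/
theorem quaternionic_heisenberg_canonical_scalar_curvature
    (p : ℕ) (hp : 1 ≤ p) (lam : ℝ) (hlam : 0 < lam) :
    ∑ a, RicT p lam (basisE p a) (basisE p a) = -12 * lam ^ 2 * ((p : ℝ) + 2) := by
  simp only [RicT_eq, ← Finset.mul_sum]
  rw [Finset.sum_comm]
  simp only [sum_Hform_mul_Hform p hlam.ne', Fin.sum_univ_three]
  ring
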